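/- Let (a_n)_{n≥0} be a bounded sequence of complex numbers and f(z) = Σ_{n=0}^∞ a_n z^n the analytic function it defines on the open unit disc 𝔻. If for every nonempty open arc I of the unit circle there exists a right limit of (a_n) that is not reflectionless on I, then f has a strong natural boundary on ∂𝔻. -/

import Mathlib

open Filter Metric Set MeasureTheory

/-- `b : ℤ → ℂ` is a right limit of `a : ℕ → ℂ`. -/
def IsRightLimit (a : ℕ → ℂ) (b : ℤ → ℂ) : Prop :=
  ∃ n : ℕ → ℕ, StrictMono n ∧
    ∀ k : ℤ, Tendsto (fun j => a (k + n j).toNat) atTop (nhds (b k))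

/-- `f_+` for a two-sided sequence. -/
noncomputable def fPlus (b : ℤ → ℂ) (z : ℂ) : ℂ := ∑' n : ℕ, b n * z ^ n

/-- `f_-` for a two-sided sequence. -/
noncomputable def fMinus (b : ℤ → ℂ) (z : ℂ) : ℂ :=
  ∑' n : ℕ, b (-(n : ℤ) - 1) * z ^ (-(n : ℤ) - 1)

/-- The open arc `{e^{iθ} : α < θ < β}` of the unit circle. -/
def arc (α β : ℝ) : Set ℂ := {z | ∃ θ ∈ Set.Ioo α β, z = Complex.exp (θ * Complex.I)}

/-- The two-sided sequence `b` is reflectionless on the arc `I`. -/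
def Reflectionless (b : ℤ → ℂ) (I : Set ℂ) : Prop :=
  ∃ g : ℂ → ℂ,
    DifferentiableOn ℂ g ((Metric.sphere (0 : ℂ) 1 \ I)ᶜ) ∧
    (∀ z ∈ Metric.ball (0 : ℂ) 1, g z = fPlus b z) ∧
    (∀ z : ℂ, 1 < ‖z‖ → g z = - fMinus b z)

/-- `f` has a strong natural boundary on the unit circle. -/
def StrongNaturalBoundary (f : ℂ → ℂ) : Prop :=
  ∀ α β : ℝ, α < β →
    ¬ ∃ M : ℝ, ∀ r : ℝ, 0 < r → r < 1 →
      (∫ θ in α..β, ‖f (r * Complex.exp (θ * Complex.I))‖) / (2 * Real.pi) ≤ M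

/-- `f` has a (classical) natural boundary on the unit circle. -/
def NaturalBoundary (f : ℂ → ℂ) : Prop :=
  ¬ ∃ z₀ : ℂ, ‖z₀‖ = 1 ∧ ∃ δ > (0 : ℝ), ∃ g : ℂ → ℂ,
    DifferentiableOn ℂ g (Metric.ball (0 : ℂ) 1 ∪ Metric.ball z₀ δ) ∧
    ∀ z ∈ Metric.ball (0 : ℂ) 1, g z = f z


/-- Cauchy-Schwarz in L2 for products of norms. -/
theorem sn_holder {X : Type*} [MeasurableSpace X] {ρ : Measure X}
    (F G : Lp ℂ 2 ρ) : ∫ x, ‖F x‖ * ‖G x‖ ∂ρ ≤ ‖F‖ * ‖G‖ := by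
  have key : ∀ F : Lp ℂ 2 ρ, (∫ x, ‖F x‖ ^ (2:ℝ) ∂ρ) ^ (1/(2:ℝ)) = ‖F‖ := by
    intro F
    rw [Lp.norm_def, (Lp.memLp F).eLpNorm_eq_integral_rpow_norm (by norm_num) (by norm_num)]
    rw [ENNReal.toReal_ofReal (by positivity)]
    simp
  have := integral_mul_norm_le_Lp_mul_Lq (μ := ρ) (f := F) (g := G) (p := 2) (q := 2)
    Real.HolderConjugate.two_two (by simpa using Lp.memLp F) (by simpa using Lp.memLp G)
  rwa [key, key] at this

theorem sn_fourier_norm {T : ℝ} (n : ℤ) (x : AddCircle T) : ‖fourier n x‖ = 1 := by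
  rw [fourier_apply]; exact Circle.norm_coe _

theorem sn_rajchman_meas {T : ℝ} [Fact (0 < T)] (ρ : Measure (AddCircle T)) [IsFiniteMeasure ρ]
    (k : Lp ℂ 2 ρ)
    (h : Tendsto (fun n : ℕ => ∫ x, fourier (n : ℤ) x * k x ∂ρ) atTop (nhds 0)) :
    Tendsto (fun n : ℕ => ∫ x, fourier (-(n : ℤ)) x * k x ∂ρ) atTop (nhds 0) := by
  have hkm : MemLp (k : AddCircle T → ℂ) 2 ρ := Lp.memLp k
  have hk1 : Integrable (k : AddCircle T → ℂ) ρ := hkm.integrable (by norm_num)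
  have hintg : ∀ (n : ℤ) (p : C(AddCircle T, ℂ)),
      Integrable (fun x => fourier n x * p x * k x) ρ := by
    intro n p
    refine hk1.bdd_mul (c := ‖fourier n * p‖) (Continuous.aestronglyMeasurable (by fun_prop)) ?_
    exact Eventually.of_forall fun x => (fourier n * p).norm_coe_le_norm x
  -- trig polynomials
  have hspan : ∀ p ∈ Submodule.span ℂ (range (@fourier T)),
      Tendsto (fun n : ℕ => ∫ x, fourier (n : ℤ) x * p x * k x ∂ρ) atTop (nhds 0) := by
    intro p hp
    induction hp using Submodule.span_induction with
    | mem p hp =>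
      obtain ⟨m, rfl⟩ := hp
      have h' : Tendsto (fun n : ℤ => ∫ x, fourier n x * k x ∂ρ) atTop (nhds 0) := by
        rw [← Nat.map_cast_int_atTop, tendsto_map'_iff]
        exact h
      have h2 : Tendsto (fun n : ℕ => (n : ℤ) + m) atTop atTop :=
        tendsto_atTop_add_const_right _ _ tendsto_natCast_atTop_atTop
      refine (h'.comp h2).congr fun n => ?_
      simp only [Function.comp, fourier_add]
    | zero => simp
    | add p q _ _ hp hq =>
      have := hp.add hq
      rw [add_zero] at this
      refine this.congr fun n => ?_
      rw [← integral_add (hintg _ _) (hintg _ _)]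
      congr 1; ext x; simp; ring
    | smul c p _ hp =>
      have := hp.const_mul c
      rw [mul_zero] at this
      refine this.congr fun n => ?_
      rw [← integral_const_mul]
      congr 1; ext x; simp; ring
  let h0 : AddCircle T → ℂ := fun x => (starRingEnd ℂ) (k x) / k x
  have hh0 : MemLp h0 2 ρ := by
    refine MemLp.of_bound (C := 1) ?_ ?_
    · have := hkm.1
      have h3 := (Complex.continuous_conj.comp_aestronglyMeasurable this)
      exact (h3.aemeasurable.div this.aemeasurable).aestronglyMeasurable
    · refine Eventually.of_forall fun x => ?_
      simp only [h0, norm_div, RCLike.norm_conj]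
      exact div_self_le_one _
  have hh0k : ∀ x, h0 x * k x = (starRingEnd ℂ) (k x) := by
    intro x
    by_cases hx : k x = 0
    · simp [h0, hx]
    · simp [h0, hx]
  have hconj : Tendsto (fun n : ℕ => ∫ x, fourier (n : ℤ) x * (starRingEnd ℂ) (k x) ∂ρ)
      atTop (nhds 0) := by
    have hdense := (ContinuousMap.toLp_denseRange ℂ ρ ℂ (p := 2)
      (by norm_num)).topologicalClosure_map_submodule (span_fourier_closure_eq_top (T := T))
    rw [Metric.tendsto_atTop]
    intro ε hε
    have hmem : hh0.toLp h0 ∈ (⊤ : Submodule ℂ (Lp ℂ 2 ρ)) := trivial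
    rw [← hdense] at hmem
    rw [← SetLike.mem_coe, Submodule.topologicalClosure_coe, Metric.mem_closure_iff] at hmem
    obtain ⟨q, hq, hdist⟩ := hmem (ε / 2 / (‖k‖ + 1)) (by positivity)
    obtain ⟨p, hp, rfl⟩ := hq
    obtain ⟨N, hN⟩ := (Metric.tendsto_atTop.1 (hspan p hp)) (ε/2) (by positivity)
    refine ⟨N, fun n hn => ?_⟩
    have h1 := hN n hn
    rw [dist_zero_right] at h1 ⊢
    set D : Lp ℂ 2 ρ := hh0.toLp h0 - ContinuousMap.toLp (p := 2) ρ ℂ p with hD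
    have hDn : ‖D‖ < ε / 2 / (‖k‖ + 1) := by
      rw [dist_eq_norm] at hdist; exact hdist
    have hDae : ∀ᵐ x ∂ρ, D x = h0 x - p x := by
      filter_upwards [Lp.coeFn_sub (hh0.toLp h0) (ContinuousMap.toLp (p := 2) ρ ℂ p),
        hh0.coeFn_toLp, ContinuousMap.coeFn_toLp (p := 2) (𝕜 := ℂ) ρ p] with x h1 h2 h3
      rw [hD, h1, Pi.sub_apply, h2, h3]
    have e1 : ∫ x, fourier (n : ℤ) x * (starRingEnd ℂ) (k x) ∂ρ
        = ∫ x, fourier (n : ℤ) x * p x * k x ∂ρ + ∫ x, fourier (n : ℤ) x * (D x * k x) ∂ρ := by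
      have hDi : Integrable (fun x => fourier (n : ℤ) x * (D x * k x)) ρ := by
        refine Integrable.bdd_mul (c := 1) ((Lp.memLp D).integrable_mul hkm)
          (Continuous.aestronglyMeasurable (by fun_prop)) ?_
        refine Eventually.of_forall fun x => ?_
        exact (sn_fourier_norm _ _).le
      rw [← integral_add (hintg _ _) hDi]
      refine integral_congr_ae ?_
      filter_upwards [hDae] with x hx
      rw [hx, ← hh0k]; ring
    have e2 : ‖∫ x, fourier (n : ℤ) x * (D x * k x) ∂ρ‖ ≤ ‖D‖ * ‖k‖ := by
      refine (norm_integral_le_integral_norm _).trans (le_trans (le_of_eq ?_) (sn_holder D k))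
      congr 1; ext x; rw [norm_mul, norm_mul, sn_fourier_norm, one_mul]
    have e3 : ‖D‖ * ‖k‖ ≤ ε / 2 := by
      have : ‖D‖ * (‖k‖ + 1) ≤ ε / 2 := by
        rw [lt_div_iff₀ (by positivity)] at hDn; exact hDn.le
      nlinarith [norm_nonneg D]
    rw [e1]
    calc _ ≤ _ := norm_add_le _ _
      _ < ε := by linarith
  have := (Complex.continuous_conj.tendsto 0).comp hconj
  rw [map_zero] at this
  refine this.congr fun n => ?_
  simp only [Function.comp]
  rw [← integral_conj]
  congr 1; ext x
  rw [map_mul, fourier_neg, Complex.conj_conj]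

theorem sn_rajchman {T : ℝ} [Fact (0 < T)] (Λ : C(AddCircle T, ℂ) →ₗ[ℂ] ℂ)
    (P : C(AddCircle T, ℝ) →ₗ[ℝ] ℝ) (hP : ∀ g, 0 ≤ g → 0 ≤ P g)
    (hΛ : ∀ (g : C(AddCircle T, ℂ)) (g' : C(AddCircle T, ℝ)), (∀ x, g' x = ‖g x‖) →
      ‖Λ g‖ ≤ P g')
    (h : Tendsto (fun n : ℕ => Λ (fourier (n : ℤ))) atTop (nhds 0)) :
    Tendsto (fun n : ℕ => Λ (fourier (-(n : ℤ)))) atTop (nhds 0) := by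
  let P' : CompactlySupportedContinuousMap (AddCircle T) ℝ →ₚ[ℝ] ℝ :=
    PositiveLinearMap.mk₀
      { toFun := fun g => P g.toContinuousMap
        map_add' := fun g g' => by rw [← map_add]; rfl
        map_smul' := fun c g => by rw [RingHom.id_apply, ← map_smul]; rfl }
      (fun g hg => hP _ hg)
  let ρ := RealRMK.rieszMeasure P'
  have hρ : ∀ g : C(AddCircle T, ℝ), ∫ x, g x ∂ρ = P g := by
    intro g
    exact RealRMK.integral_rieszMeasure P'
      (CompactlySupportedContinuousMap.continuousMapEquiv g)
  let e : C(AddCircle T, ℂ) →ₗ[ℂ] Lp ℂ 2 ρ := (ContinuousMap.toLp (p := 2) ρ ℂ).toLinearMap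
  have he : DenseRange e := ContinuousMap.toLp_denseRange ℂ ρ ℂ (p := 2) (by norm_num)
  have hb : ∃ C, ∀ x, ‖Λ x‖ ≤ C * ‖e x‖ := by
    refine ⟨‖e 1‖, fun g => ?_⟩
    refine (hΛ g ⟨fun x => ‖g x‖, by fun_prop⟩ (fun x => rfl)).trans ?_
    rw [← hρ]
    refine le_trans (le_of_eq ?_) (sn_holder (e 1) (e g))
    refine integral_congr_ae ?_
    filter_upwards [ContinuousMap.coeFn_toLp (p := 2) (𝕜 := ℂ) ρ g,
      ContinuousMap.coeFn_toLp (p := 2) (𝕜 := ℂ) ρ (1 : C(AddCircle T, ℂ))] with x h1 h2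
    simp only [e, ContinuousLinearMap.coe_coe, h1, h2]
    simp
  let Λ' : Lp ℂ 2 ρ →L[ℂ] ℂ := Λ.extendOfNorm e
  let k0 : Lp ℂ 2 ρ := (InnerProductSpace.toDual ℂ (Lp ℂ 2 ρ)).symm Λ'
  have hk0 : ∀ g : C(AddCircle T, ℂ), Λ g = ∫ x, g x * (starRingEnd ℂ) (k0 x) ∂ρ := by
    intro g
    have h1 : Λ' (e g) = Λ g := LinearMap.extendOfNorm_eq he hb g
    have h2 : inner ℂ k0 (e g) = Λ' (e g) := InnerProductSpace.toDual_symm_apply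
    rw [← h1, ← h2, L2.inner_def]
    refine integral_congr_ae ?_
    filter_upwards [ContinuousMap.coeFn_toLp (p := 2) (𝕜 := ℂ) ρ g] with x h1
    simp only [e, ContinuousLinearMap.coe_coe, h1]
    simp
  have hm : MemLp (fun x => (starRingEnd ℂ) (k0 x)) 2 ρ := by
    have := (Lp.memLp k0).star
    exact this
  have hkk : ∀ g : C(AddCircle T, ℂ), Λ g = ∫ x, g x * (hm.toLp _) x ∂ρ := by
    intro g
    rw [hk0]
    refine integral_congr_ae ?_
    filter_upwards [hm.coeFn_toLp] with x hx
    rw [hx]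
  simp only [hkk] at h ⊢
  exact sn_rajchman_meas ρ _ h

/-- Pointwise limits of linear functionals along an ultrafilter. -/
theorem sn_lim_linear {𝕜 E ι : Type*} [RCLike 𝕜] [AddCommGroup E] [Module 𝕜 E]
    (U : Ultrafilter ι) (L : ι → E →ₗ[𝕜] 𝕜)
    (hb : ∀ g, ∃ B, ∀ᶠ i in (U : Filter ι), ‖L i g‖ ≤ B) :
    ∃ Λ : E →ₗ[𝕜] 𝕜, ∀ g, Tendsto (fun i => L i g) U (nhds (Λ g)) := by
  have hex : ∀ g, ∃ l, Tendsto (fun i => L i g) U (nhds l) := by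
    intro g
    obtain ⟨B, hB⟩ := hb g
    obtain ⟨l, -, hl⟩ := (isCompact_closedBall (0 : 𝕜) B).ultrafilter_le_nhds
      (U.map fun i => L i g) (by
        rw [Filter.le_principal_iff]
        change ∀ᶠ i in (U : Filter ι), L i g ∈ closedBall 0 B
        filter_upwards [hB] with i hi
        simpa using hi)
    exact ⟨l, hl⟩
  choose l hl using hex
  refine ⟨{ toFun := l, map_add' := ?_, map_smul' := ?_ }, hl⟩
  · intro x y
    refine tendsto_nhds_unique (hl (x + y)) (((hl x).add (hl y)).congr fun i => ?_)
    rw [map_add]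
  · intro c x
    refine tendsto_nhds_unique (hl (c • x)) (((hl x).const_smul c).congr fun i => ?_)
    rw [map_smul]

/-- The exponential `e^{ilθ}`. -/
noncomputable def snE (l : ℤ) (θ : ℝ) : ℂ := Complex.exp ((l : ℂ) * θ * Complex.I)

/-- Fourier coefficient on the interval of length `2π` centred at `c`. -/
noncomputable def snF (c : ℝ) (φ : ℝ → ℂ) (l : ℤ) : ℂ :=
  ∫ θ in (c - Real.pi)..(c + Real.pi), snE l θ * φ θ

theorem snE_norm (l : ℤ) (θ : ℝ) : ‖snE l θ‖ = 1 := by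
  have : snE l θ = Complex.exp (((l * θ : ℝ) : ℂ) * Complex.I) := by simp [snE]
  rw [this, Complex.norm_exp_ofReal_mul_I]

theorem snE_cont (l : ℤ) : Continuous (snE l) := by unfold snE; fun_prop

theorem snE_add (l m : ℤ) (θ : ℝ) : snE (l + m) θ = snE l θ * snE m θ := by
  simp only [snE, ← Complex.exp_add]; congr 1; push_cast; ring

theorem snE_pow (r θ : ℝ) (m : ℕ) :
    ((r : ℂ) * Complex.exp (θ * Complex.I)) ^ m = (r : ℂ) ^ m * snE m θ := by
  rw [mul_pow, ← Complex.exp_nat_mul]; simp [snE, mul_assoc]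

theorem snE_fourier [Fact (0 < 2 * Real.pi)] (l : ℤ) (θ : ℝ) :
    fourier l (θ : AddCircle (2 * Real.pi)) = snE l θ := by
  rw [fourier_coe_apply, snE]
  congr 1
  have : (Real.pi : ℂ) ≠ 0 := by exact_mod_cast Real.pi_ne_zero
  push_cast
  field_simp

theorem sn_local (a : ℕ → ℂ) (C : ℝ) (hC : ∀ n, ‖a n‖ ≤ C)
    (f : ℂ → ℂ) (hf : ∀ z ∈ Metric.ball (0 : ℂ) 1, f z = ∑' n : ℕ, a n * z ^ n)
    (c : ℝ) (φ : ℝ → ℂ) (hφ : Continuous φ) (hsum : Summable fun l : ℤ => ‖snF c φ l‖)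
    (M : ℝ) (hM : ∀ r : ℝ, 0 < r → r < 1 →
      ∫ θ in (c - Real.pi)..(c + Real.pi), ‖φ θ * f (r * Complex.exp (θ * Complex.I))‖ ≤ M) :
    Tendsto (fun n : ℕ => ∑' m : ℕ, a m * snF c φ (m - n)) atTop (nhds 0) := by
  have hC0 : 0 ≤ C := (norm_nonneg _).trans (hC 0)
  have hpi := Real.pi_pos
  have : Fact (0 < 2 * Real.pi) := ⟨by positivity⟩
  have hle : c - Real.pi ≤ c + Real.pi := by linarith
  -- values on circles
  let G : ℝ → ℝ → ℂ := fun r θ => ∑' m : ℕ, a m * r ^ m * snE m θ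
  have hGb : ∀ r : ℝ, 0 < r → r < 1 → ∀ (m : ℕ) (θ : ℝ), ‖a m * r ^ m * snE m θ‖ ≤ C * r ^ m := by
    intro r h0 h1 m θ
    rw [norm_mul, norm_mul, snE_norm, mul_one, norm_pow, Complex.norm_real, Real.norm_of_nonneg h0.le]
    exact mul_le_mul_of_nonneg_right (hC m) (by positivity)
  have hgs : ∀ r : ℝ, 0 < r → r < 1 → Summable fun m : ℕ => C * r ^ m := fun r h0 h1 =>
    (summable_geometric_of_lt_one h0.le h1).mul_left C
  have hGf : ∀ r : ℝ, 0 < r → r < 1 → ∀ θ : ℝ, f (r * Complex.exp (θ * Complex.I)) = G r θ := by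
    intro r h0 h1 θ
    rw [hf _ (by simp [Complex.norm_exp_ofReal_mul_I, abs_of_pos h0, h1])]
    simp only [G]
    congr 1; ext m; rw [snE_pow]; ring
  have hGc : ∀ r : ℝ, 0 < r → r < 1 → Continuous (G r) := by
    intro r h0 h1
    exact continuous_tsum (fun m => continuous_const.mul (snE_cont m)) (hgs r h0 h1)
      (hGb r h0 h1)
  have hfc : ∀ r : ℝ, 0 < r → r < 1 →
      Continuous fun θ : ℝ => f (r * Complex.exp (θ * Complex.I)) := by
    intro r h0 h1
    have : (fun θ : ℝ => f (r * Complex.exp (θ * Complex.I))) = G r := funext (hGf r h0 h1)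
    rw [this]; exact hGc r h0 h1
  -- a clamped version, so that everything is continuous for all parameters
  let u : ℝ → ℝ → ℂ := fun r θ => if 0 < r ∧ r < 1 then φ θ * f (r * Complex.exp (θ * Complex.I)) else 0
  have huc : ∀ r, Continuous (u r) := by
    intro r
    by_cases h : 0 < r ∧ r < 1
    · simp only [u, h, and_self, if_true]; exact hφ.mul (hfc r h.1 h.2)
    · simp only [u, h, if_false]; exact continuous_const
  have hcoe : Continuous fun θ : ℝ => (θ : AddCircle (2 * Real.pi)) := AddCircle.continuous_mk' _
  have huM : ∀ r, ∫ θ in (c - Real.pi)..(c + Real.pi), ‖u r θ‖ ≤ max M 0 := by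
    intro r
    by_cases h : 0 < r ∧ r < 1
    · simp only [u, h, and_self, if_true]; exact (hM r h.1 h.2).trans (le_max_left _ _)
    · simp [u, h]
  let L : ℝ → C(AddCircle (2 * Real.pi), ℂ) →ₗ[ℂ] ℂ := fun r =>
    { toFun := fun g => ∫ θ in (c - Real.pi)..(c + Real.pi), g (θ : AddCircle (2 * Real.pi)) * u r θ
      map_add' := by
        intro g g'
        simp only [ContinuousMap.add_apply, add_mul]
        exact intervalIntegral.integral_add
          (((g.continuous.comp hcoe).mul (huc r)).intervalIntegrable _ _)
          (((g'.continuous.comp hcoe).mul (huc r)).intervalIntegrable _ _)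
      map_smul' := by
        intro s g
        rw [RingHom.id_apply, smul_eq_mul, ← intervalIntegral.integral_const_mul]
        simp only [ContinuousMap.smul_apply, smul_eq_mul, mul_assoc] }
  let Q : ℝ → C(AddCircle (2 * Real.pi), ℝ) →ₗ[ℝ] ℝ := fun r =>
    { toFun := fun g => ∫ θ in (c - Real.pi)..(c + Real.pi), g (θ : AddCircle (2 * Real.pi)) * ‖u r θ‖
      map_add' := by
        intro g g'
        simp only [ContinuousMap.add_apply, add_mul]
        exact intervalIntegral.integral_add
          (((g.continuous.comp hcoe).mul (huc r).norm).intervalIntegrable _ _)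
          (((g'.continuous.comp hcoe).mul (huc r).norm).intervalIntegrable _ _)
      map_smul' := by
        intro s g
        rw [RingHom.id_apply, smul_eq_mul, ← intervalIntegral.integral_const_mul]
        simp only [ContinuousMap.smul_apply, smul_eq_mul, mul_assoc] }
  have hLQ : ∀ r (g : C(AddCircle (2 * Real.pi), ℂ)) (g' : C(AddCircle (2 * Real.pi), ℝ)),
      (∀ x, g' x = ‖g x‖) → ‖L r g‖ ≤ Q r g' := by
    intro r g g' hg
    refine (intervalIntegral.norm_integral_le_integral_norm hle).trans (le_of_eq ?_)
    simp only [norm_mul, ← hg]; rfl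
  have hQb : ∀ r (g : C(AddCircle (2 * Real.pi), ℝ)), ‖Q r g‖ ≤ ‖g‖ * max M 0 := by
    intro r g
    refine (intervalIntegral.norm_integral_le_integral_norm hle).trans ?_
    refine le_trans ?_ (mul_le_mul_of_nonneg_left (huM r) (norm_nonneg g))
    rw [← intervalIntegral.integral_const_mul]
    refine intervalIntegral.integral_mono_on hle ?_ ?_ fun θ _ => ?_
    · exact (((g.continuous.comp hcoe).mul (huc r).norm).norm).intervalIntegrable _ _
    · exact ((huc r).norm.const_mul _).intervalIntegrable _ _
    · rw [norm_mul, norm_norm]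
      exact mul_le_mul_of_nonneg_right (g.norm_coe_le_norm _) (norm_nonneg _)
  let U : Ultrafilter ℝ := Ultrafilter.of (nhdsWithin (1 : ℝ) (Iio 1))
  have hU : (U : Filter ℝ) ≤ nhdsWithin (1 : ℝ) (Iio 1) := Ultrafilter.of_le _
  obtain ⟨P, hP⟩ := sn_lim_linear U Q (fun g => ⟨_, Eventually.of_forall fun r => hQb r g⟩)
  obtain ⟨Λ, hΛ⟩ := sn_lim_linear U L (fun g => ⟨_, Eventually.of_forall fun r =>
    (hLQ r g ⟨fun x => ‖g x‖, by fun_prop⟩ fun x => rfl).trans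
      ((le_abs_self _).trans (hQb r _))⟩)
  have hr01 : ∀ᶠ r in nhdsWithin (1 : ℝ) (Iio 1), 0 < r ∧ r < 1 := by
    filter_upwards [self_mem_nhdsWithin, mem_nhdsWithin_of_mem_nhds (lt_mem_nhds (zero_lt_one' ℝ))]
      with r h1 h2
    exact ⟨h2, h1⟩
  have hval : ∀ k : ℤ, Λ (fourier k) = ∑' m : ℕ, a m * snF c φ (m + k) := by
    intro k
    have hsk : Summable fun m : ℕ => C * ‖snF c φ (m + k)‖ := by
      refine Summable.mul_left C ?_
      exact hsum.comp_injective (i := fun m : ℕ => (m : ℤ) + k)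
        (fun x y h => by simpa using h)
    have h1 : Tendsto (fun r : ℝ => ∑' m : ℕ, a m * (r : ℂ) ^ m * snF c φ (m + k))
        (nhdsWithin (1 : ℝ) (Iio 1)) (nhds (∑' m : ℕ, a m * snF c φ (m + k))) := by
      refine tendsto_tsum_of_dominated_convergence hsk (fun m => ?_) ?_
      · have : Tendsto (fun r : ℝ => a m * (r : ℂ) ^ m * snF c φ (m + k)) (nhds 1)
            (nhds (a m * ((1 : ℝ) : ℂ) ^ m * snF c φ (m + k))) := by
          apply Continuous.tendsto; fun_prop
        simpa using this.mono_left nhdsWithin_le_nhds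
      · filter_upwards [hr01] with r hr m
        rw [norm_mul, norm_mul, norm_pow, Complex.norm_real, Real.norm_of_nonneg hr.1.le]
        refine mul_le_mul_of_nonneg_right ?_ (norm_nonneg _)
        calc ‖a m‖ * r ^ m ≤ C * 1 :=
              mul_le_mul (hC m) (pow_le_one₀ hr.1.le hr.2.le) (pow_nonneg hr.1.le _) hC0
          _ = C := mul_one C
    refine tendsto_nhds_unique (hΛ (fourier k)) ((h1.mono_left hU).congr' ?_)
    filter_upwards [hU hr01] with r hr
    have h2 : L r (fourier k)
        = ∫ θ in (c - Real.pi)..(c + Real.pi), snE k θ * (φ θ * G r θ) := by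
      change ∫ θ in (c - Real.pi)..(c + Real.pi), fourier k (θ : AddCircle (2 * Real.pi)) * u r θ = _
      refine intervalIntegral.integral_congr fun θ _ => ?_
      simp only [u, hr, and_self, if_true, snE_fourier, hGf r hr.1 hr.2]
    rw [h2]
    have h3 := intervalIntegral.hasSum_integral_of_dominated_convergence (μ := volume)
      (a := c - Real.pi) (b := c + Real.pi)
      (F := fun (m : ℕ) θ => snE k θ * (φ θ * (a m * r ^ m * snE m θ)))
      (f := fun θ => snE k θ * (φ θ * G r θ))
      (fun m θ => ‖φ θ‖ * (C * r ^ m))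
      (fun m => by
        refine Continuous.aestronglyMeasurable ?_
        exact (snE_cont k).mul (hφ.mul (continuous_const.mul (snE_cont m))))
      (fun m => Eventually.of_forall fun θ _ => by
        rw [norm_mul, snE_norm, one_mul, norm_mul]
        exact mul_le_mul_of_nonneg_left (hGb r hr.1 hr.2 m θ) (norm_nonneg _))
      (Eventually.of_forall fun θ _ => (hgs r hr.1 hr.2).mul_left _)
      (by
        simp only [tsum_mul_left]
        exact (hφ.norm.mul continuous_const).intervalIntegrable _ _)
      (Eventually.of_forall fun θ _ => by
        refine HasSum.mul_left _ (HasSum.mul_left _ ?_)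
        exact (Summable.of_norm_bounded (hgs r hr.1 hr.2) (fun m => hGb r hr.1 hr.2 m θ)).hasSum)
    rw [← h3.tsum_eq]
    congr 1; ext m
    rw [snF, ← intervalIntegral.integral_const_mul]
    refine intervalIntegral.integral_congr fun θ _ => ?_
    simp only [snE_add]; ring
  have hplus : Tendsto (fun n : ℕ => Λ (fourier (n : ℤ))) atTop (nhds 0) := by
    have h1 := tendsto_sum_nat_add fun l : ℕ => C * ‖snF c φ l‖
    refine squeeze_zero_norm (fun n => ?_) h1
    rw [hval]
    refine tsum_of_norm_bounded (Summable.hasSum ?_) fun m => ?_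
    · refine Summable.mul_left C ?_
      exact hsum.comp_injective (i := fun m : ℕ => ((m + n : ℕ) : ℤ))
        (fun x y h => by simpa using h)
    · rw [norm_mul]; push_cast
      exact mul_le_mul_of_nonneg_right (hC m) (norm_nonneg _)
  have := sn_rajchman Λ P (fun g hg => ?_) (fun g g' hg => ?_) hplus
  · refine this.congr fun n => ?_
    rw [hval]; rfl
  · refine ge_of_tendsto (hP g) (Eventually.of_forall fun r => ?_)
    exact intervalIntegral.integral_nonneg hle fun θ _ => mul_nonneg (hg _) (norm_nonneg _)
  · exact le_of_tendsto_of_tendsto (hΛ g).norm (hP g') (Eventually.of_forall fun r => hLQ r g g' hg)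

theorem sn_right (a : ℕ → ℂ) (C : ℝ) (hC : ∀ n, ‖a n‖ ≤ C) (b : ℤ → ℂ) (n : ℕ → ℕ)
    (hn : StrictMono n) (hb : ∀ k : ℤ, Tendsto (fun j => a (k + n j).toNat) atTop (nhds (b k)))
    (Φ : ℤ → ℂ) (hΦ : Summable fun l => ‖Φ l‖)
    (h : Tendsto (fun n : ℕ => ∑' m : ℕ, a m * Φ (m - n)) atTop (nhds 0)) :
    ∑' k : ℤ, b k * Φ k = 0 := by
  have h1 := h.comp hn.tendsto_atTop
  have h2 : Tendsto (fun j => ∑' k : ℤ, if 0 ≤ k + n j then a (k + n j).toNat * Φ k else 0) atTop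
      (nhds (∑' k : ℤ, b k * Φ k)) := by
    refine tendsto_tsum_of_dominated_convergence (hΦ.mul_left C) (fun k => ?_) ?_
    · refine ((hb k).mul_const (Φ k)).congr' ?_
      filter_upwards [hn.tendsto_atTop.eventually_ge_atTop (-k).toNat] with j hj
      rw [if_pos (by omega)]
    · refine Eventually.of_forall fun j k => ?_
      have hC0 : 0 ≤ C := (norm_nonneg _).trans (hC 0)
      split_ifs
      · rw [norm_mul]; exact mul_le_mul_of_nonneg_right (hC _) (norm_nonneg _)
      · rw [norm_zero]; positivity
  refine tendsto_nhds_unique h2 (h1.congr fun j => ?_)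
  have hinj : Function.Injective fun m : ℕ => (m : ℤ) - n j := fun x y h => by simpa using h
  rw [← hinj.tsum_eq (f := fun k : ℤ => if 0 ≤ k + n j then a (k + n j).toNat * Φ k else 0)]
  · simp
  · intro k hk
    have : 0 ≤ k + n j := by
      by_contra hcon
      simp [hcon] at hk
    exact ⟨(k + n j).toNat, by simp; omega⟩

theorem sn_summable : Summable fun l : ℤ => (1 + (l : ℝ) ^ 2)⁻¹ := by
  have h := Real.summable_one_div_int_pow.2 (one_lt_two)
  refine Summable.of_norm_bounded_eventually h ?_
  rw [Filter.eventually_cofinite]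
  refine (Set.finite_singleton (0 : ℤ)).subset fun l hl => ?_
  by_contra hne
  apply hl
  have h0 : (0 : ℝ) < (l : ℝ) ^ 2 := by
    have : (l : ℝ) ≠ 0 := by exact_mod_cast hne
    positivity
  rw [Real.norm_of_nonneg (by positivity), one_div]
  exact inv_anti₀ h0 (by linarith)

theorem snE_deriv (l : ℤ) (θ : ℝ) : HasDerivAt (snE l) (l * Complex.I * snE l θ) θ := by
  have h1 : HasDerivAt (fun θ : ℝ => (l : ℂ) * (θ : ℂ) * Complex.I) ((l : ℂ) * 1 * Complex.I) θ :=
    ((Complex.ofRealCLM.hasDerivAt).const_mul (l : ℂ)).mul_const Complex.I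
  have := h1.cexp
  refine this.congr_deriv ?_
  rw [snE]; ring

theorem snE_periodic (l : ℤ) (c : ℝ) : snE l (c + Real.pi) = snE l (c - Real.pi) := by
  have h : c + Real.pi = (c - Real.pi) + 2 * Real.pi := by ring
  rw [h, snE, snE]
  push_cast
  have : (l : ℂ) * (↑c - ↑Real.pi + 2 * ↑Real.pi) * Complex.I
      = (l : ℂ) * (↑c - ↑Real.pi) * Complex.I + l * (2 * Real.pi * Complex.I) := by ring
  rw [this, Complex.exp_add, Complex.exp_int_mul_two_pi_mul_I, mul_one]

theorem sn_ibp (c : ℝ) (F F1 : ℝ → ℂ) (l : ℤ)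
    (hd : ∀ θ ∈ Icc (c - Real.pi) (c + Real.pi), HasDerivAt F (F1 θ) θ)
    (hc : ContinuousOn F1 (Icc (c - Real.pi) (c + Real.pi)))
    (he : F (c + Real.pi) = F (c - Real.pi)) :
    snF c F1 l = - (l * Complex.I * snF c F l) := by
  have hle : c - Real.pi ≤ c + Real.pi := by linarith [Real.pi_pos]
  have huI : uIcc (c - Real.pi) (c + Real.pi) = Icc (c - Real.pi) (c + Real.pi) := uIcc_of_le hle
  have := intervalIntegral.integral_mul_deriv_eq_deriv_mul (a := c - Real.pi) (b := c + Real.pi)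
    (u := snE l) (v := F) (u' := fun θ => l * Complex.I * snE l θ) (v' := F1)
    (fun θ _ => snE_deriv l θ) (fun θ hθ => hd θ (huI ▸ hθ))
    ((continuous_const.mul (snE_cont l)).intervalIntegrable _ _)
    (ContinuousOn.intervalIntegrable (huI ▸ hc))
  rw [snF, this, snE_periodic, he, sub_self, zero_sub, snF, ← intervalIntegral.integral_const_mul]
  simp only [mul_assoc]

theorem sn_bound (c : ℝ) (F : ℝ → ℂ) (l : ℤ) (B : ℝ)
    (hB : ∀ θ ∈ Icc (c - Real.pi) (c + Real.pi), ‖F θ‖ ≤ B) : ‖snF c F l‖ ≤ B * (2 * Real.pi) := by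
  have hle : c - Real.pi ≤ c + Real.pi := by linarith [Real.pi_pos]
  have := intervalIntegral.norm_integral_le_of_norm_le_const (a := c - Real.pi) (b := c + Real.pi)
    (f := fun θ => snE l θ * F θ) (C := B) (fun θ hθ => by
      rw [norm_mul, snE_norm, one_mul]
      rw [uIoc_of_le hle] at hθ
      exact hB θ (Ioc_subset_Icc_self hθ))
  have h2 : |c + Real.pi - (c - Real.pi)| = 2 * Real.pi := by
    rw [abs_of_nonneg (by linarith)]; ring
  rwa [h2] at this

theorem sn_decay (c : ℝ) (F F1 F2 : ℝ → ℂ) (l : ℤ) (B : ℝ)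
    (hd : ∀ θ ∈ Icc (c - Real.pi) (c + Real.pi), HasDerivAt F (F1 θ) θ)
    (hd1 : ∀ θ ∈ Icc (c - Real.pi) (c + Real.pi), HasDerivAt F1 (F2 θ) θ)
    (hc : ContinuousOn F2 (Icc (c - Real.pi) (c + Real.pi)))
    (he : F (c + Real.pi) = F (c - Real.pi)) (he1 : F1 (c + Real.pi) = F1 (c - Real.pi))
    (hB : ∀ θ ∈ Icc (c - Real.pi) (c + Real.pi), ‖F θ‖ ≤ B)
    (hB2 : ∀ θ ∈ Icc (c - Real.pi) (c + Real.pi), ‖F2 θ‖ ≤ B) :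
    ‖snF c F l‖ ≤ 4 * Real.pi * B * (1 + (l : ℝ) ^ 2)⁻¹ := by
  have h1 := sn_ibp c F F1 l hd (fun θ hθ => (hd1 θ hθ).continuousAt.continuousWithinAt) he
  have h2 := sn_ibp c F1 F2 l hd1 hc he1
  have e0 := sn_bound c F l B hB
  have e2 := sn_bound c F2 l B hB2
  have : snF c F2 l = -((l : ℂ) ^ 2 * snF c F l) := by
    rw [h2, h1]; linear_combination (l : ℂ) ^ 2 * snF c F l * Complex.I_sq
  rw [this, norm_neg, norm_mul, norm_pow, Complex.norm_intCast, sq_abs] at e2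
  rw [← div_eq_mul_inv, le_div_iff₀ (by positivity)]
  nlinarith

/-- The Cauchy kernel. -/
noncomputable def snK (z : ℂ) (θ : ℝ) : ℂ := (1 - z * snE (-1) θ)⁻¹

theorem snK_deriv (z : ℂ) (θ : ℝ) (h : 1 - z * snE (-1) θ ≠ 0) :
    HasDerivAt (snK z) (Complex.I * (snK z θ - snK z θ ^ 2)) θ := by
  have h1 := (((snE_deriv (-1) θ).const_mul z).const_sub 1).inv h
  refine h1.congr_deriv ?_
  rw [snK]; field_simp; push_cast; ring

theorem snK_kernel (c : ℝ) (w w1 w2 : ℝ → ℝ) (hw : ∀ θ, HasDerivAt w (w1 θ) θ)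
    (hw1 : ∀ θ, HasDerivAt w1 (w2 θ) θ) (hw2 : Continuous w2)
    (he : w (c + Real.pi) = w (c - Real.pi)) (he1 : w1 (c + Real.pi) = w1 (c - Real.pi))
    (A D : ℝ) (hD : 0 ≤ D)
    (hA : ∀ θ ∈ Icc (c - Real.pi) (c + Real.pi), |w θ| ≤ A)
    (hA1 : ∀ θ ∈ Icc (c - Real.pi) (c + Real.pi), |w1 θ| ≤ A)
    (hA2 : ∀ θ ∈ Icc (c - Real.pi) (c + Real.pi), |w2 θ| ≤ A)
    (z : ℂ)
    (hz : ∀ θ ∈ Icc (c - Real.pi) (c + Real.pi),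
      (‖snK z θ‖ ≤ D ∧ 1 - z * snE (-1) θ ≠ 0) ∨ w =ᶠ[nhds θ] 0) (l : ℤ) :
    ‖snF c (fun θ => (w θ : ℂ) * snK z θ) l‖ ≤
      4 * Real.pi * (A * (D + 2 * (D + D ^ 2) + (D + D ^ 2) * (1 + 2 * D))) * (1 + (l : ℝ) ^ 2)⁻¹ := by
  have hz1 : ∀ θ, w =ᶠ[nhds θ] 0 → w1 =ᶠ[nhds θ] 0 := by
    intro θ h
    filter_upwards [h.eventuallyEq_nhds] with t ht
    have h1 := (hasDerivAt_const t (0:ℝ)).congr_of_eventuallyEq ht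
    exact (hw t).unique h1
  have hz2 : ∀ θ, w =ᶠ[nhds θ] 0 → w2 =ᶠ[nhds θ] 0 := by
    intro θ h
    filter_upwards [(hz1 θ h).eventuallyEq_nhds] with t ht
    have h1 := (hasDerivAt_const t (0:ℝ)).congr_of_eventuallyEq ht
    exact (hw1 t).unique h1
  have hcw : ∀ θ, HasDerivAt (fun θ => (w θ : ℂ)) (w1 θ : ℂ) θ := fun θ => (hw θ).ofReal_comp
  have hcw1 : ∀ θ, HasDerivAt (fun θ => (w1 θ : ℂ)) (w2 θ : ℂ) θ := fun θ => (hw1 θ).ofReal_comp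
  have hKper : snK z (c + Real.pi) = snK z (c - Real.pi) := by rw [snK, snK, snE_periodic]
  have hA0 : 0 ≤ A := (abs_nonneg _).trans (hA c ⟨by linarith [Real.pi_pos], by linarith [Real.pi_pos]⟩)
  refine sn_decay c _
    (fun θ => w1 θ * snK z θ + w θ * (Complex.I * (snK z θ - snK z θ ^ 2)))
    (fun θ => w2 θ * snK z θ + 2 * (w1 θ * (Complex.I * (snK z θ - snK z θ ^ 2)))
      - w θ * ((snK z θ - snK z θ ^ 2) * (1 - 2 * snK z θ))) l _ ?_ ?_ ?_ ?_ ?_ ?_ ?_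
  · intro θ hθ
    rcases hz θ hθ with h | h
    · exact (hcw θ).mul (snK_deriv z θ h.2)
    · have e1 := (hz1 θ h).self_of_nhds
      have e0 := h.self_of_nhds
      simp only [Pi.zero_apply] at e1 e0
      rw [e1, e0]
      simp only [Complex.ofReal_zero, zero_mul, add_zero]
      refine (hasDerivAt_const θ (0:ℂ)).congr_of_eventuallyEq ?_
      filter_upwards [h] with t ht
      rw [ht]; simp
  · intro θ hθ
    rcases hz θ hθ with h | h
    · have hK := snK_deriv z θ h.2
      have := ((hcw1 θ).mul hK).add ((hcw θ).mul ((hK.sub (hK.pow 2)).const_mul Complex.I))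
      refine this.congr_deriv ?_
      simp only [Pi.sub_apply, Pi.pow_apply]
      push_cast
      linear_combination (w θ * ((snK z θ - snK z θ ^ 2) * (1 - 2 * snK z θ))) * Complex.I_sq
    · have e1 := (hz1 θ h).self_of_nhds
      have e0 := h.self_of_nhds
      have e2 := (hz2 θ h).self_of_nhds
      simp only [Pi.zero_apply] at e1 e0 e2
      rw [e1, e0, e2]
      simp only [Complex.ofReal_zero, zero_mul, add_zero, mul_zero, sub_zero]
      refine (hasDerivAt_const θ (0:ℂ)).congr_of_eventuallyEq ?_
      filter_upwards [h, hz1 θ h] with t ht ht1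
      rw [ht, ht1]; simp
  · intro θ hθ
    refine ContinuousAt.continuousWithinAt ?_
    rcases hz θ hθ with h | h
    · have hK := (snK_deriv z θ h.2).continuousAt
      have c0 := (hcw θ).continuousAt
      have c1 := (hcw1 θ).continuousAt
      have c2 : ContinuousAt (fun θ => (w2 θ : ℂ)) θ :=
        (Complex.continuous_ofReal.comp hw2).continuousAt
      fun_prop
    · refine (continuousAt_const (y := (0:ℂ))).congr ?_
      filter_upwards [h, hz1 θ h, hz2 θ h] with t ht ht1 ht2
      rw [ht, ht1, ht2]; simp
  · simp only [he, hKper]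
  · simp only [he, he1, hKper]
  · intro θ hθ
    rw [norm_mul, Complex.norm_real, Real.norm_eq_abs]
    rcases hz θ hθ with h | h
    · refine (mul_le_mul (hA θ hθ) h.1 (norm_nonneg _) hA0).trans ?_
      refine mul_le_mul_of_nonneg_left ?_ hA0
      have : 0 ≤ 2 * (D + D ^ 2) + (D + D ^ 2) * (1 + 2 * D) := by positivity
      linarith
    · have e0 := h.self_of_nhds
      simp only [Pi.zero_apply] at e0
      rw [e0, abs_zero, zero_mul]; positivity
  · intro θ hθ
    rcases hz θ hθ with h | h
    · have k1 : ‖snK z θ - snK z θ ^ 2‖ ≤ D + D ^ 2 := by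
        refine (norm_sub_le _ _).trans (add_le_add h.1 ?_)
        rw [norm_pow]; exact pow_le_pow_left₀ (norm_nonneg _) h.1 2
      have k2 : ‖1 - 2 * snK z θ‖ ≤ 1 + 2 * D := by
        refine (norm_sub_le _ _).trans ?_
        rw [norm_mul, norm_one, Complex.norm_ofNat]
        linarith [h.1]
      refine (norm_sub_le _ _).trans ?_
      rw [mul_add, mul_add]
      refine add_le_add ((norm_add_le _ _).trans (add_le_add ?_ ?_)) ?_
      · rw [norm_mul, Complex.norm_real, Real.norm_eq_abs]
        exact mul_le_mul (hA2 θ hθ) h.1 (norm_nonneg _) hA0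
      · rw [norm_mul, norm_mul, norm_mul, Complex.norm_real, Real.norm_eq_abs, Complex.norm_I, one_mul,
          Complex.norm_ofNat]
        have := mul_le_mul (hA1 θ hθ) k1 (norm_nonneg _) hA0
        linarith
      · rw [norm_mul, norm_mul, Complex.norm_real, Real.norm_eq_abs]
        exact mul_le_mul (hA θ hθ) (mul_le_mul k1 k2 (norm_nonneg _) (by positivity))
          (by positivity) hA0
    · have e1 := (hz1 θ h).self_of_nhds
      have e0 := h.self_of_nhds
      have e2 := (hz2 θ h).self_of_nhds
      simp only [Pi.zero_apply] at e1 e0 e2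
      rw [e1, e0, e2]
      simp
      positivity

theorem snK_ne (z : ℂ) (hz : ‖z‖ ≠ 1) (θ : ℝ) : 1 - z * snE (-1) θ ≠ 0 := by
  intro h
  apply hz
  have : z * snE (-1) θ = 1 := (sub_eq_zero.1 h).symm
  have h2 := congrArg norm this
  rwa [norm_mul, snE_norm, mul_one, norm_one] at h2

theorem snK_cont (z : ℂ) (hz : ‖z‖ ≠ 1) : Continuous (snK z) := by
  unfold snK
  exact (continuous_const.sub (continuous_const.mul (snE_cont _))).inv₀ (snK_ne z hz)

theorem snK_norm_le (z : ℂ) (hz : ‖z‖ ≠ 1) (θ : ℝ) : ‖snK z θ‖ ≤ |1 - ‖z‖|⁻¹ := by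
  rw [snK, norm_inv]
  have h0 : 0 < |1 - ‖z‖| := abs_pos.2 (sub_ne_zero.2 (Ne.symm hz))
  refine inv_anti₀ h0 ?_
  have := abs_norm_sub_norm_le (1 : ℂ) (z * snE (-1) θ)
  rwa [norm_mul, snE_norm, mul_one, norm_one] at this

theorem snK_rec (c : ℝ) (z : ℂ) (hz : ‖z‖ ≠ 1) (l : ℤ) :
    snF c (snK z) l = z * snF c (snK z) (l - 1) + if l = 0 then 2 * (Real.pi : ℂ) else 0 := by
  have h1 : snF c (snK z) l - z * snF c (snK z) (l - 1)
      = ∫ θ in (c - Real.pi)..(c + Real.pi), snE l θ := by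
    rw [snF, snF, ← intervalIntegral.integral_const_mul, ← intervalIntegral.integral_sub]
    · refine intervalIntegral.integral_congr fun θ _ => ?_
      have h := snK_ne z hz θ
      simp only [sub_eq_add_neg l 1, snE_add]
      have : snK z θ * (1 - z * snE (-1) θ) = 1 := inv_mul_cancel₀ h
      linear_combination snE l θ * this
    · exact ((snE_cont _).mul (snK_cont z hz)).intervalIntegrable _ _
    · exact (continuous_const.mul ((snE_cont _).mul (snK_cont z hz))).intervalIntegrable _ _
  have h2 : ∫ θ in (c - Real.pi)..(c + Real.pi), snE l θ = if l = 0 then 2 * (Real.pi : ℂ) else 0 := by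
    split_ifs with h
    · subst h
      simp [snE]; ring
    · have hl : (l : ℂ) ≠ 0 := by exact_mod_cast h
      have h3 : ∀ θ ∈ uIcc (c - Real.pi) (c + Real.pi),
          HasDerivAt (fun θ => ((l : ℂ) * Complex.I)⁻¹ * snE l θ) (snE l θ) θ := fun θ _ => by
        refine ((snE_deriv l θ).const_mul _).congr_deriv ?_
        rw [← mul_assoc, inv_mul_cancel₀ (mul_ne_zero hl Complex.I_ne_zero), one_mul]
      rw [intervalIntegral.integral_eq_sub_of_hasDerivAt h3 ((snE_cont l).intervalIntegrable _ _),
        snE_periodic, sub_self]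
  rw [← h2, ← h1]; ring

theorem snK_in (c : ℝ) (z : ℂ) (hz : ‖z‖ < 1) :
    (∀ n : ℕ, snF c (snK z) n = 2 * Real.pi * z ^ n) ∧ ∀ l : ℤ, l < 0 → snF c (snK z) l = 0 := by
  have hb : ∀ l, ‖snF c (snK z) l‖ ≤ |1 - ‖z‖|⁻¹ * (2 * Real.pi) := fun l =>
    sn_bound c _ l _ fun θ _ => snK_norm_le z hz.ne θ
  have hneg : ∀ l : ℤ, l < 0 → snF c (snK z) l = 0 := by
    intro l hl
    have hp : ∀ m : ℕ, snF c (snK z) l = z ^ m * snF c (snK z) (l - m) := by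
      intro m
      induction m with
      | zero => simp
      | succ m ih =>
        rw [ih, snK_rec c z hz.ne (l - m), if_neg (by omega), add_zero, ← mul_assoc, ← pow_succ]
        congr 2; push_cast; ring
    have ht : Tendsto (fun m : ℕ => ‖z‖ ^ m * (|1 - ‖z‖|⁻¹ * (2 * Real.pi))) atTop (nhds 0) := by
      simpa using (tendsto_pow_atTop_nhds_zero_of_lt_one (norm_nonneg z) hz).mul_const
        (|1 - ‖z‖|⁻¹ * (2 * Real.pi))
    refine tendsto_nhds_unique tendsto_const_nhds (squeeze_zero_norm (fun m : ℕ => ?_) ht)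
    rw [hp m, norm_mul, norm_pow]
    exact mul_le_mul_of_nonneg_left (hb _) (by positivity)
  refine ⟨fun n => ?_, hneg⟩
  induction n with
  | zero => rw [snK_rec c z hz.ne, hneg _ (by simp)]; simp
  | succ n ih =>
    rw [snK_rec c z hz.ne, if_neg (by omega)]
    have : ((n + 1 : ℕ) : ℤ) - 1 = n := by push_cast; ring
    rw [this, ih]; ring

theorem snK_out (c : ℝ) (z : ℂ) (hz : 1 < ‖z‖) :
    (∀ n : ℕ, snF c (snK z) (-(n : ℤ) - 1) = - (2 * Real.pi * z ^ (-(n : ℤ) - 1))) ∧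
      ∀ l : ℤ, 0 ≤ l → snF c (snK z) l = 0 := by
  have hz0 : z ≠ 0 := by rintro rfl; simp at hz; linarith
  have hb : ∀ l, ‖snF c (snK z) l‖ ≤ |1 - ‖z‖|⁻¹ * (2 * Real.pi) := fun l =>
    sn_bound c _ l _ fun θ _ => snK_norm_le z hz.ne' θ
  have hpos : ∀ l : ℤ, 0 ≤ l → snF c (snK z) l = 0 := by
    intro l hl
    have hp : ∀ m : ℕ, snF c (snK z) l = (z⁻¹) ^ m * snF c (snK z) (l + m) := by
      intro m
      induction m with
      | zero => simp
      | succ m ih =>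
        rw [ih, snK_rec c z hz.ne' (l + (m + 1 : ℕ)), if_neg (by omega), add_zero]
        have : l + ((m + 1 : ℕ) : ℤ) - 1 = l + m := by push_cast; ring
        rw [this, pow_succ]; field_simp
    have hz1 : ‖z⁻¹‖ < 1 := by rw [norm_inv]; exact inv_lt_one_of_one_lt₀ hz
    have ht : Tendsto (fun m : ℕ => ‖z⁻¹‖ ^ m * (|1 - ‖z‖|⁻¹ * (2 * Real.pi))) atTop (nhds 0) := by
      simpa using (tendsto_pow_atTop_nhds_zero_of_lt_one (norm_nonneg _) hz1).mul_const
        (|1 - ‖z‖|⁻¹ * (2 * Real.pi))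
    refine tendsto_nhds_unique tendsto_const_nhds (squeeze_zero_norm (fun m : ℕ => ?_) ht)
    rw [hp m, norm_mul, norm_pow]
    exact mul_le_mul_of_nonneg_left (hb _) (by positivity)
  refine ⟨fun n => ?_, hpos⟩
  induction n with
  | zero =>
    have := snK_rec c z hz.ne' 0
    rw [hpos 0 le_rfl, if_pos rfl] at this
    have h2 : z * snF c (snK z) (0 - 1) = - (2 * Real.pi) := by linear_combination -this
    simp only [Nat.cast_zero, neg_zero]
    rw [zero_sub] at h2 ⊢
    rw [zpow_neg_one]
    field_simp
    linear_combination h2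
  | succ n ih =>
    have := snK_rec c z hz.ne' (-(n : ℤ) - 1)
    rw [if_neg (by omega), add_zero, ih] at this
    have e : -((n + 1 : ℕ) : ℤ) - 1 = -(n : ℤ) - 1 - 1 := by push_cast; ring
    rw [e, zpow_sub_one₀ hz0]
    apply mul_left_cancel₀ hz0
    rw [← this]
    field_simp

theorem sn_cont_circle (a : ℕ → ℂ) (C : ℝ) (hC : ∀ n, ‖a n‖ ≤ C)
    (f : ℂ → ℂ) (hf : ∀ z ∈ Metric.ball (0 : ℂ) 1, f z = ∑' n : ℕ, a n * z ^ n)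
    (r : ℝ) (h0 : 0 < r) (h1 : r < 1) :
    Continuous fun θ : ℝ => f (r * Complex.exp (θ * Complex.I)) := by
  have hGf : ∀ θ : ℝ, f (r * Complex.exp (θ * Complex.I)) = ∑' m : ℕ, a m * r ^ m * snE m θ := by
    intro θ
    rw [hf _ (by simp [Complex.norm_exp_ofReal_mul_I, abs_of_pos h0, h1])]
    congr 1; ext m; rw [snE_pow]; ring
  simp only [hGf]
  refine continuous_tsum (u := fun m : ℕ => C * r ^ m)
    (fun m => continuous_const.mul (snE_cont m))
    ((summable_geometric_of_lt_one h0.le h1).mul_left C) fun m θ => ?_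
  rw [norm_mul, norm_mul, snE_norm, mul_one, norm_pow, Complex.norm_real, Real.norm_of_nonneg h0.le]
  exact mul_le_mul_of_nonneg_right (hC m) (by positivity)

theorem snK_diff (c : ℝ) (w : ℝ → ℝ) (hw : Continuous w) (A D : ℝ)
    (hA : ∀ θ ∈ Icc (c - Real.pi) (c + Real.pi), |w θ| ≤ A) (V : Set ℂ) (hV : IsOpen V)
    (hz : ∀ z ∈ V, ∀ θ ∈ Icc (c - Real.pi) (c + Real.pi),
      (‖snK z θ‖ ≤ D ∧ 1 - z * snE (-1) θ ≠ 0) ∨ w =ᶠ[nhds θ] 0) (l : ℤ) :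
    DifferentiableOn ℂ (fun z => snF c (fun θ => (w θ : ℂ) * snK z θ) l) V := by
  intro z0 hz0
  refine DifferentiableAt.differentiableWithinAt ?_
  have hle : c - Real.pi ≤ c + Real.pi := by linarith [Real.pi_pos]
  have hA0 : 0 ≤ A := (abs_nonneg _).trans (hA c ⟨by linarith [Real.pi_pos], by linarith [Real.pi_pos]⟩)
  have hKm : ∀ z, Measurable (snK z) := fun z =>
    ((continuous_const.sub (continuous_const.mul (snE_cont _))).measurable).inv
  have hwm : Measurable fun θ => (w θ : ℂ) := (Complex.continuous_ofReal.comp hw).measurable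
  have hm1 : ∀ z, Measurable fun θ => snE l θ * ((w θ : ℂ) * snK z θ) := fun z =>
    (snE_cont l).measurable.mul (hwm.mul (hKm z))
  have hwz : ∀ z ∈ V, ∀ θ ∈ Icc (c - Real.pi) (c + Real.pi), w θ = 0 ∨
      (‖snK z θ‖ ≤ D ∧ 1 - z * snE (-1) θ ≠ 0) := fun z hzV θ hθ => by
    rcases hz z hzV θ hθ with h | h
    · exact Or.inr h
    · exact Or.inl h.self_of_nhds
  have huI : ∀ θ, θ ∈ uIoc (c - Real.pi) (c + Real.pi) → θ ∈ Icc (c - Real.pi) (c + Real.pi) := by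
    intro θ h; rw [uIoc_of_le hle] at h; exact Ioc_subset_Icc_self h
  have := intervalIntegral.hasDerivAt_integral_of_dominated_loc_of_deriv_le (𝕜 := ℂ) (μ := volume)
    (a := c - Real.pi) (b := c + Real.pi) (bound := fun _ => A * D ^ 2)
    (F := fun z θ => snE l θ * ((w θ : ℂ) * snK z θ))
    (F' := fun z θ => snE l θ * ((w θ : ℂ) * (snE (-1) θ * snK z θ ^ 2))) (x₀ := z0)
    (hV.mem_nhds hz0) (Eventually.of_forall fun z => (hm1 z).aestronglyMeasurable)
    (by
      refine ContinuousOn.intervalIntegrable ?_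
      rw [uIcc_of_le hle]
      intro θ hθ
      refine ContinuousAt.continuousWithinAt ?_
      refine (snE_cont l).continuousAt.mul ?_
      rcases hz z0 hz0 θ hθ with h | h
      · exact (Complex.continuous_ofReal.comp hw).continuousAt.mul (snK_deriv z0 θ h.2).continuousAt
      · refine (continuousAt_const (y := (0:ℂ))).congr ?_
        filter_upwards [h] with t ht
        rw [ht]; simp)
    ((snE_cont l).measurable.mul (hwm.mul ((snE_cont _).measurable.mul
      ((hKm z0).pow_const 2)))).aestronglyMeasurable
    (Eventually.of_forall fun θ hθ z hzV => by
      rw [norm_mul, snE_norm, one_mul, norm_mul, norm_mul, snE_norm, one_mul, norm_pow,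
        Complex.norm_real, Real.norm_eq_abs]
      rcases hwz z hzV θ (huI θ hθ) with h | h
      · rw [h, abs_zero, zero_mul]; positivity
      · exact mul_le_mul (hA θ (huI θ hθ)) (pow_le_pow_left₀ (norm_nonneg _) h.1 2) (by positivity) hA0)
    (continuous_const.intervalIntegrable _ _)
    (Eventually.of_forall fun θ hθ z hzV => by
      refine HasDerivAt.const_mul _ ?_
      rcases hwz z hzV θ (huI θ hθ) with h | h
      · simp only [h, Complex.ofReal_zero, zero_mul]; exact hasDerivAt_const _ _
      · refine HasDerivAt.const_mul _ ?_
        have := (((hasDerivAt_id z).mul_const (snE (-1) θ)).const_sub 1).inv h.2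
        refine this.congr_deriv ?_
        simp [snK]; field_simp)
  exact this.2.differentiableAt

theorem sn_main (a : ℕ → ℂ) (C : ℝ) (hC : ∀ n, ‖a n‖ ≤ C)
    (f : ℂ → ℂ) (hf : ∀ z ∈ Metric.ball (0 : ℂ) 1, f z = ∑' n : ℕ, a n * z ^ n)
    (c R : ℝ) (hR : 0 < R) (hR1 : R ≤ 1) (M : ℝ)
    (hM : ∀ r : ℝ, 0 < r → r < 1 →
      (∫ θ in (c - R)..(c + R), ‖f (r * Complex.exp (θ * Complex.I))‖) ≤ M)
    (b : ℤ → ℂ) (hb : IsRightLimit a b) : Reflectionless b (arc (c - R / 2) (c + R / 2)) := by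
  have hpi := Real.pi_gt_three
  have hle : c - Real.pi ≤ c + Real.pi := by linarith
  obtain ⟨n, hn, hbn⟩ := hb
  have hbC : ∀ k, ‖b k‖ ≤ C := fun k =>
    le_of_tendsto (hbn k).norm (Eventually.of_forall fun j => hC _)
  have hC0 : 0 ≤ C := (norm_nonneg _).trans (hC 0)
  let ψ : ContDiffBump c := ⟨R / 2, R, by positivity, by linarith⟩
  have hψ2 : ContDiff ℝ 2 ψ := ψ.contDiff
  have hψd : ∀ θ, HasDerivAt ψ (deriv ψ θ) θ := fun θ =>
    (hψ2.differentiable (by norm_num) θ).hasDerivAt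
  have hψ1 : ContDiff ℝ 1 (deriv ψ) := by
    have h2 : ContDiff ℝ (1 + 1) ψ := by
      have : (1 + 1 : WithTop ℕ∞) = 2 := by norm_num
      rw [this]; exact hψ2
    exact (contDiff_succ_iff_deriv.1 h2).2.2
  have hψd1 : ∀ θ, HasDerivAt (deriv ψ) (deriv (deriv ψ) θ) θ := fun θ =>
    (hψ1.differentiable (by norm_num) θ).hasDerivAt
  have hψc2 : Continuous (deriv (deriv ψ)) := hψ1.continuous_deriv (by norm_num)
  have hψ0 : ∀ θ, R ≤ |θ - c| → ψ θ = 0 := fun θ h => ψ.zero_of_le_dist h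
  have hψ01 : ∀ θ, R < |θ - c| → deriv ψ θ = 0 := by
    intro θ h
    have h1 : ψ =ᶠ[nhds θ] fun _ => (0:ℝ) := by
      have : ∀ᶠ t in nhds θ, R < |t - c| :=
        (continuous_abs.comp (continuous_id.sub continuous_const)).continuousAt.eventually
          (lt_mem_nhds h)
      filter_upwards [this] with t ht
      exact hψ0 t ht.le
    rw [h1.deriv_eq, deriv_const]
  have hRp : R < |c + Real.pi - c| := by rw [add_sub_cancel_left, abs_of_pos (by linarith)]; linarith
  have hRm : R < |c - Real.pi - c| := by
    rw [sub_sub_cancel_left, abs_neg, abs_of_pos (by linarith)]; linarith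
  have eψ : ψ (c + Real.pi) = ψ (c - Real.pi) := by rw [hψ0 _ hRp.le, hψ0 _ hRm.le]
  have eψ1 : deriv ψ (c + Real.pi) = deriv ψ (c - Real.pi) := by rw [hψ01 _ hRp, hψ01 _ hRm]
  let η : ℝ → ℝ := fun θ => 1 - ψ θ
  have hηd : ∀ θ, HasDerivAt η (-deriv ψ θ) θ := fun θ => (hψd θ).const_sub 1
  have hηd1 : ∀ θ, HasDerivAt (fun θ => -deriv ψ θ) (-deriv (deriv ψ) θ) θ := fun θ => (hψd1 θ).neg
  have hηc : Continuous η := continuous_const.sub ψ.continuous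
  have hη0 : ∀ θ, |θ - c| < R / 2 → η =ᶠ[nhds θ] 0 := by
    intro θ h
    have : ∀ᶠ t in nhds θ, |t - c| < R / 2 :=
      (continuous_abs.comp (continuous_id.sub continuous_const)).continuousAt.eventually
        (gt_mem_nhds h)
    filter_upwards [this] with t ht
    have : ψ t = 1 := ψ.one_of_mem_closedBall (by rw [mem_closedBall, Real.dist_eq]; exact ht.le)
    simp [η, this]
  -- common bound
  obtain ⟨A1, hA1⟩ := (isCompact_Icc (a := c - Real.pi) (b := c + Real.pi)).exists_bound_of_continuousOn
    hψ1.continuous.continuousOn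
  obtain ⟨A2, hA2⟩ := (isCompact_Icc (a := c - Real.pi) (b := c + Real.pi)).exists_bound_of_continuousOn
    hψc2.continuousOn
  simp only [Real.norm_eq_abs] at hA1 hA2
  let A := max 1 (max A1 A2)
  have hAψ : ∀ θ ∈ Icc (c - Real.pi) (c + Real.pi), |ψ θ| ≤ A := fun θ _ => by
    rw [abs_of_nonneg ψ.nonneg]; exact ψ.le_one.trans (le_max_left _ _)
  have hAη : ∀ θ ∈ Icc (c - Real.pi) (c + Real.pi), |η θ| ≤ A := fun θ _ => by
    have h1 : (0:ℝ) ≤ ψ θ := ψ.nonneg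
    have h2 : ψ θ ≤ 1 := ψ.le_one
    refine le_trans ?_ (le_max_left _ _)
    simp only [η]; rw [abs_of_nonneg (by linarith)]; linarith
  have hAψ1 : ∀ θ ∈ Icc (c - Real.pi) (c + Real.pi), |deriv ψ θ| ≤ A := fun θ hθ =>
    (hA1 θ hθ).trans ((le_max_left _ _).trans (le_max_right _ _))
  have hAψ2 : ∀ θ ∈ Icc (c - Real.pi) (c + Real.pi), |deriv (deriv ψ) θ| ≤ A := fun θ hθ =>
    (hA2 θ hθ).trans ((le_max_right _ _).trans (le_max_right _ _))
  let B : ℝ → ℝ := fun D =>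
    4 * Real.pi * (A * (D + 2 * (D + D ^ 2) + (D + D ^ 2) * (1 + 2 * D)))
  have hηdecay : ∀ (z : ℂ) (D : ℝ), 0 ≤ D → (∀ θ ∈ Icc (c - Real.pi) (c + Real.pi),
      (‖snK z θ‖ ≤ D ∧ 1 - z * snE (-1) θ ≠ 0) ∨ η =ᶠ[nhds θ] 0) → ∀ l : ℤ,
      ‖snF c (fun θ => (η θ : ℂ) * snK z θ) l‖ ≤ B D * (1 + (l : ℝ) ^ 2)⁻¹ := by
    intro z D hD hz l
    refine snK_kernel c η (fun θ => -deriv ψ θ) (fun θ => -deriv (deriv ψ) θ) hηd hηd1 hψc2.neg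
      ?_ ?_ A D hD hAη ?_ ?_ z hz l
    · simp only [η, eψ]
    · simp only [eψ1]
    · intro θ hθ; rw [abs_neg]; exact hAψ1 θ hθ
    · intro θ hθ; rw [abs_neg]; exact hAψ2 θ hθ
  let g : ℂ → ℂ := fun z => (2 * Real.pi : ℂ)⁻¹ *
    ∑' l : ℤ, b l * snF c (fun θ => (η θ : ℂ) * snK z θ) l
  -- off the circle
  have hoff : ∀ z : ℂ, ‖z‖ ≠ 1 → g z = (2 * Real.pi : ℂ)⁻¹ * ∑' l : ℤ, b l * snF c (snK z) l := by
    intro z hz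
    have hD0 : 0 ≤ |1 - ‖z‖|⁻¹ := by positivity
    have hcond : ∀ θ, ‖snK z θ‖ ≤ |1 - ‖z‖|⁻¹ ∧ 1 - z * snE (-1) θ ≠ 0 := fun θ =>
      ⟨snK_norm_le z hz θ, snK_ne z hz θ⟩
    have hηs := hηdecay z _ hD0 (fun θ _ => Or.inl (hcond θ))
    have hψs : ∀ l : ℤ, ‖snF c (fun θ => (ψ θ : ℂ) * snK z θ) l‖ ≤
        B |1 - ‖z‖|⁻¹ * (1 + (l : ℝ) ^ 2)⁻¹ :=
      snK_kernel c ψ (deriv ψ) (deriv (deriv ψ)) hψd hψd1 hψc2 eψ eψ1 A _ hD0 hAψ hAψ1 hAψ2 z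
        (fun θ _ => Or.inl (hcond θ))
    have hψsum : Summable fun l : ℤ => ‖snF c (fun θ => (ψ θ : ℂ) * snK z θ) l‖ :=
      Summable.of_nonneg_of_le (fun _ => norm_nonneg _) hψs (sn_summable.mul_left _)
    have hηsum : Summable fun l : ℤ => ‖snF c (fun θ => (η θ : ℂ) * snK z θ) l‖ :=
      Summable.of_nonneg_of_le (fun _ => norm_nonneg _) hηs (sn_summable.mul_left _)
    have hbsum : ∀ Φ : ℤ → ℂ, (Summable fun l => ‖Φ l‖) → Summable fun l => b l * Φ l := by
      intro Φ h
      refine Summable.of_norm_bounded (h.mul_left C) fun l => ?_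
      rw [norm_mul]; exact mul_le_mul_of_nonneg_right (hbC l) (norm_nonneg _)
    have hφc : Continuous fun θ => (ψ θ : ℂ) * snK z θ :=
      (Complex.continuous_ofReal.comp ψ.continuous).mul (snK_cont z hz)
    have hloc := sn_local a C hC f hf c (fun θ => (ψ θ : ℂ) * snK z θ) hφc hψsum
      (|1 - ‖z‖|⁻¹ * M) (fun r h0 h1 => by
        have hfc := sn_cont_circle a C hC f hf r h0 h1
        have hsupp : Function.support
            (fun θ : ℝ => ‖(ψ θ : ℂ) * snK z θ * f (r * Complex.exp (θ * Complex.I))‖)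
            ⊆ Ioo (c - R) (c + R) := by
          intro θ hθ
          by_contra hcon
          have : R ≤ |θ - c| := by
            by_contra hlt
            rw [not_le, abs_lt] at hlt
            exact hcon ⟨by linarith, by linarith⟩
          apply hθ
          simp [hψ0 θ this]
        rw [intervalIntegral.integral_eq_integral_of_support_subset (hsupp.trans
          (fun θ hθ => ⟨by linarith [hθ.1], by linarith [hθ.2]⟩)),
          ← intervalIntegral.integral_eq_integral_of_support_subset (hsupp.trans Ioo_subset_Ioc_self)]
        refine le_trans ?_ (mul_le_mul_of_nonneg_left (hM r h0 h1) hD0)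
        rw [← intervalIntegral.integral_const_mul]
        refine intervalIntegral.integral_mono_on (by linarith)
          ((hφc.mul hfc).norm.intervalIntegrable _ _)
          ((continuous_const.mul hfc.norm).intervalIntegrable _ _) fun θ _ => ?_
        rw [norm_mul, norm_mul, Complex.norm_real, Real.norm_of_nonneg ψ.nonneg]
        refine mul_le_mul_of_nonneg_right ?_ (norm_nonneg _)
        calc ψ θ * ‖snK z θ‖ ≤ 1 * |1 - ‖z‖|⁻¹ :=
              mul_le_mul ψ.le_one (hcond θ).1 (norm_nonneg _) zero_le_one
          _ = _ := one_mul _)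
    have hzero := sn_right a C hC b n hn hbn _ hψsum hloc
    simp only [g]
    congr 1
    rw [← add_zero (∑' l : ℤ, b l * snF c (fun θ => (η θ : ℂ) * snK z θ) l), ← hzero,
      ← (hbsum _ hηsum).tsum_add (hbsum _ hψsum)]
    congr 1; ext l
    rw [← mul_add]
    congr 1
    rw [snF, snF, snF, ← intervalIntegral.integral_add]
    · refine intervalIntegral.integral_congr fun θ _ => ?_
      simp only [η]; push_cast; ring
    · exact ((snE_cont l).mul ((Complex.continuous_ofReal.comp hηc).mul
        (snK_cont z hz))).intervalIntegrable _ _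
    · exact ((snE_cont l).mul hφc).intervalIntegrable _ _
  have h2pi : (2 * Real.pi : ℂ) ≠ 0 := by
    have : (Real.pi : ℂ) ≠ 0 := by exact_mod_cast Real.pi_ne_zero
    exact mul_ne_zero two_ne_zero this
  refine ⟨g, ?_, ?_, ?_⟩
  · intro z0 hz0
    refine DifferentiableAt.differentiableWithinAt ?_
    let S : Set ℝ := Icc (c - Real.pi) (c + Real.pi) ∩ {θ | R / 2 ≤ |θ - c|}
    have hS : IsCompact S := isCompact_Icc.inter_right
      (isClosed_le continuous_const (continuous_abs.comp (continuous_id.sub continuous_const)))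
    have hSne : S.Nonempty := ⟨c + Real.pi, ⟨hle, le_rfl⟩, by
      change R / 2 ≤ |c + Real.pi - c|
      linarith⟩
    have hne : ∀ θ ∈ S, 1 - z0 * snE (-1) θ ≠ 0 := by
      intro θ hθ h
      have h1 : z0 * snE (-1) θ = 1 := (sub_eq_zero.1 h).symm
      have h2 : z0 = Complex.exp (θ * Complex.I) := by
        have h3 : snE (-1) θ * Complex.exp (θ * Complex.I) = 1 := by
          rw [snE, ← Complex.exp_add]; simp
        calc z0 = z0 * (snE (-1) θ * Complex.exp (θ * Complex.I)) := by rw [h3, mul_one]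
          _ = _ := by rw [← mul_assoc, h1, one_mul]
      have hsph : z0 ∈ sphere (0:ℂ) 1 := by
        rw [mem_sphere_zero_iff_norm, h2, Complex.norm_exp_ofReal_mul_I]
      have harc : z0 ∈ arc (c - R / 2) (c + R / 2) := by
        by_contra hcon
        exact hz0 ⟨hsph, hcon⟩
      obtain ⟨θ0, hθ0, h4⟩ := harc
      rw [h2, Complex.exp_eq_exp_iff_exists_int] at h4
      obtain ⟨m, hm⟩ := h4
      have hm' : θ = θ0 + m * (2 * Real.pi) := by
        have : (θ : ℂ) * Complex.I = ((θ0 + m * (2 * Real.pi) : ℝ) : ℂ) * Complex.I := by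
          rw [hm]; push_cast; ring
        exact_mod_cast mul_right_cancel₀ Complex.I_ne_zero this
      have hm0 : m = 0 := by
        have l1 : (m : ℝ) * (2 * Real.pi) < 1 * (2 * Real.pi) := by
          linarith [hθ.1.2, hθ0.1]
        have l2 : (-1 : ℝ) * (2 * Real.pi) < m * (2 * Real.pi) := by
          linarith [hθ.1.1, hθ0.2]
        have l3 := lt_of_mul_lt_mul_right l1 (by positivity)
        have l4 := lt_of_mul_lt_mul_right l2 (by positivity)
        have l5 : m < 1 := by exact_mod_cast l3
        have l6 : -1 < m := by exact_mod_cast l4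
        omega
      rw [hm0] at hm'
      have h5 : R / 2 ≤ |θ - c| := hθ.2
      have h6 : |θ - c| < R / 2 := by
        rw [abs_lt]; constructor <;> simp at hm' <;> linarith [hθ0.1, hθ0.2]
      linarith
    obtain ⟨θm, hθm, hmin⟩ := hS.exists_isMinOn hSne
      (f := fun θ => ‖1 - z0 * snE (-1) θ‖)
      ((continuous_const.sub (continuous_const.mul (snE_cont _))).norm.continuousOn)
    set m := ‖1 - z0 * snE (-1) θm‖ with hm
    have hm0 : 0 < m := norm_pos_iff.2 (hne θm hθm)
    have hcond : ∀ z ∈ ball z0 (m / 2), ∀ θ ∈ Icc (c - Real.pi) (c + Real.pi),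
        (‖snK z θ‖ ≤ (m / 2)⁻¹ ∧ 1 - z * snE (-1) θ ≠ 0) ∨ η =ᶠ[nhds θ] 0 := by
      intro z hz θ hθ
      by_cases hS' : R / 2 ≤ |θ - c|
      · left
        have h1 : m ≤ ‖1 - z0 * snE (-1) θ‖ := hmin ⟨hθ, hS'⟩
        have h2 : ‖1 - z0 * snE (-1) θ‖ ≤ ‖1 - z * snE (-1) θ‖ + ‖z - z0‖ := by
          have : 1 - z0 * snE (-1) θ = (1 - z * snE (-1) θ) + (z - z0) * snE (-1) θ := by ring
          rw [this]
          refine (norm_add_le _ _).trans (le_of_eq ?_)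
          rw [norm_mul, snE_norm, mul_one]
        rw [mem_ball, dist_eq_norm] at hz
        have h3 : m / 2 ≤ ‖1 - z * snE (-1) θ‖ := by linarith
        refine ⟨?_, norm_pos_iff.1 (by linarith)⟩
        rw [snK, norm_inv]
        exact inv_anti₀ (by positivity) h3
      · exact Or.inr (hη0 θ (not_le.1 hS'))
    have hdiff : DifferentiableOn ℂ g (ball z0 (m / 2)) := by
      refine DifferentiableOn.const_mul ?_ _
      refine Complex.differentiableOn_tsum_of_summable_norm
        (u := fun l : ℤ => C * (B (m / 2)⁻¹ * (1 + (l : ℝ) ^ 2)⁻¹))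
        ((sn_summable.mul_left _).mul_left _) (fun l => ?_) isOpen_ball (fun l z hz => ?_)
      · exact (snK_diff c η hηc A _ hAη _ isOpen_ball hcond l).const_mul _
      · rw [norm_mul]
        exact mul_le_mul (hbC l) (hηdecay z _ (by positivity) (hcond z hz) l) (norm_nonneg _) hC0
    exact hdiff.differentiableAt (ball_mem_nhds z0 (by positivity))
  · intro z hz
    rw [mem_ball_zero_iff] at hz
    obtain ⟨hp, hneg⟩ := snK_in c z hz
    rw [hoff z hz.ne, fPlus]
    have hinj : Function.Injective fun m : ℕ => (m : ℤ) := fun x y h => by simpa using h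
    rw [← hinj.tsum_eq (f := fun l : ℤ => b l * snF c (snK z) l), ← tsum_mul_left]
    · congr 1; ext m
      rw [hp m]; field_simp
    · intro l hl
      have : 0 ≤ l := by
        by_contra hcon
        apply hl
        simp only [hneg l (by omega), mul_zero]
      exact ⟨l.toNat, by simp; omega⟩
  · intro z hz
    obtain ⟨hp, hpos⟩ := snK_out c z hz
    rw [hoff z hz.ne', fMinus]
    have hinj : Function.Injective fun m : ℕ => -(m : ℤ) - 1 := fun x y h => by simpa using h
    rw [← hinj.tsum_eq (f := fun l : ℤ => b l * snF c (snK z) l), ← tsum_mul_left, ← tsum_neg]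
    · congr 1; ext m
      rw [hp m]; field_simp
    · intro l hl
      have : l < 0 := by
        by_contra hcon
        apply hl
        simp only [hpos l (by omega), mul_zero]
      exact ⟨(-l - 1).toNat, by simp; omega⟩

theorem stmt2 (a : ℕ → ℂ) (C : ℝ) (hC : ∀ n, ‖a n‖ ≤ C)
    (f : ℂ → ℂ) (hf : ∀ z ∈ Metric.ball (0 : ℂ) 1, f z = ∑' n : ℕ, a n * z ^ n)
    (h : ∀ α β : ℝ, α < β →
      ∃ b : ℤ → ℂ, IsRightLimit a b ∧ ¬ Reflectionless b (arc α β)) :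
    StrongNaturalBoundary f := by
  rintro α β hαβ ⟨M, hM⟩
  let c := (α + β) / 2
  let R := min ((β - α) / 2) 1
  have hR : 0 < R := lt_min (by linarith) one_pos
  have hRle : R ≤ (β - α) / 2 := min_le_left _ _
  obtain ⟨b, hb, hnot⟩ := h (c - R / 2) (c + R / 2) (by linarith)
  refine hnot (sn_main a C hC f hf c R hR (min_le_right _ _) (M * (2 * Real.pi)) ?_ b hb)
  intro r h0 h1
  have h2 := hM r h0 h1
  rw [div_le_iff₀ (by positivity)] at h2
  refine le_trans ?_ h2
  have hfc := (sn_cont_circle a C hC f hf r h0 h1).norm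
  refine intervalIntegral.integral_mono_interval ?_ ?_ ?_ ?_ (hfc.intervalIntegrable _ _)
  · simp only [c]; linarith
  · linarith
  · simp only [c]; linarith
  · exact Eventually.of_forall fun θ => norm_nonneg _
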